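/- There exists an absolute constant c > 0 such that for every n ∈ ℕ, every convex symmetric body V ⊂ ℝⁿ with V ⊆ B₂ⁿ, and every linear subspace L ⊆ ℝⁿ of dimension m (1 ≤ m ≤ n), the Euclidean diameter of the central section satisfies diam(V ∩ L) ≥ (2c / M_V)^{n/m} · ω_{n,m}, where ω_{n,m} = (Γ(n/2 + 1) / (Γ((n−m)/2 + 1) · Γ(m/2 + 1)))^{1/m} and M_V is the Lévy mean of the gauge of V. -/

import Mathlib

open MeasureTheory Metric Set

/-- A convex symmetric body in `ℝⁿ`: a compact convex set with `0` in its interior,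
satisfying `V = -V`. -/
def IsSymmBody (n : ℕ) (V : Set (EuclideanSpace ℝ (Fin n))) : Prop :=
  IsCompact V ∧ Convex ℝ V ∧ (0 : EuclideanSpace ℝ (Fin n)) ∈ interior V ∧ V = -V

/-- The Lévy mean of a function on `ℝⁿ`: its average over the unit Euclidean sphere
with respect to the rotation-invariant probability measure (the normalization of the
spherical measure `volume.toSphere`). -/
noncomputable def levyMean (n : ℕ) (f : EuclideanSpace ℝ (Fin n) → ℝ) : ℝ :=
  ⨍ x : sphere (0 : EuclideanSpace ℝ (Fin n)) 1,
    f x ∂((volume : Measure (EuclideanSpace ℝ (Fin n))).toSphere)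

/-- `ω_{n,m} = (Γ(n/2 + 1) / (Γ((n−m)/2 + 1) · Γ(m/2 + 1)))^{1/m}`. -/
noncomputable def omegaNM (n m : ℕ) : ℝ :=
  (Real.Gamma ((n : ℝ) / 2 + 1) /
      (Real.Gamma (((n : ℝ) - (m : ℝ)) / 2 + 1) * Real.Gamma ((m : ℝ) / 2 + 1))) ^ (1 / (m : ℝ))

/-- Volume of a closed ball in a finite-dimensional inner product space, including dimension `0`. -/
theorem volume_closedBall_finrank {E : Type*} [NormedAddCommGroup E] [InnerProductSpace ℝ E]
    [FiniteDimensional ℝ E] [MeasurableSpace E] [BorelSpace E] (x : E) {r : ℝ} (hr : 0 ≤ r) :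
    (volume : Measure E) (closedBall x r) =
      ENNReal.ofReal (r ^ Module.finrank ℝ E * (√Real.pi ^ Module.finrank ℝ E /
        Real.Gamma ((Module.finrank ℝ E : ℝ) / 2 + 1))) := by
  rcases subsingleton_or_nontrivial E with h | h
  · have h0 : Module.finrank ℝ E = 0 := Module.finrank_zero_of_subsingleton
    have hball : closedBall x r = univ := by
      ext y
      simp [Subsingleton.elim y x, hr]
    have hv : (volume : Measure E) univ = 1 := by
      have := (stdOrthonormalBasis ℝ E).volume_parallelepiped
      rwa [Subsingleton.eq_univ_of_nonempty (s := parallelepiped _)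
        ⟨0, (mem_parallelepiped_iff _ _).2 ⟨0, by simp, Subsingleton.elim _ _⟩⟩] at this
    rw [hball, hv, h0]
    simp
  · rw [InnerProductSpace.volume_closedBall, ENNReal.ofReal_mul (by positivity),
      ENNReal.ofReal_pow hr]

theorem norm_add_orthogonal_sq {E : Type*} [NormedAddCommGroup E]
    [InnerProductSpace ℝ E] (L : Submodule ℝ E) (x : L) (y : Lᗮ) :
    ‖(x + y : E)‖ ^ 2 = ‖x‖ ^ 2 + ‖y‖ ^ 2 := by
  simpa only [sq, Submodule.norm_coe] using
    norm_add_sq_eq_norm_sq_add_norm_sq_of_inner_eq_zero (x : E) (y : E)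
      (Submodule.inner_right_of_mem_orthogonal x.2 y.2)

section OrthogonalSum

variable {E : Type*} [NormedAddCommGroup E] [InnerProductSpace ℝ E] [FiniteDimensional ℝ E]
  [MeasurableSpace E] [BorelSpace E] (L : Submodule ℝ E)

theorem measurePreserving_add_orthogonal :
    MeasurePreserving (fun p : L × Lᗮ ↦ (p.1 + p.2 : E)) := by
  have h := L.orthogonalDecomposition.symm.measurePreserving.comp
    (WithLp.volume_preserving_toLp L Lᗮ)
  convert h using 2 with p
  simp

/-- If all sections of a subset of the unit ball by translates of `L` have diameter at most `D`,
then its volume is at most that of the product of the `D`-ball of `L` and the unit ball of `Lᗮ`. -/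
theorem volume_le_of_slices {V : Set E} (hV : MeasurableSet V) (hVB : V ⊆ closedBall 0 1) {D : ℝ}
    (hslice : ∀ x ∈ V, ∀ y ∈ V, x - y ∈ L → ‖x - y‖ ≤ D) :
    volume V ≤ (volume : Measure L) (closedBall 0 D) * (volume : Measure Lᗮ) (closedBall 0 1) := by
  set e : L × Lᗮ → E := fun p ↦ p.1 + p.2 with he
  have hmp : MeasurePreserving e := measurePreserving_add_orthogonal L
  have hslices : ∀ y : Lᗮ, volume ((fun x ↦ (x, y)) ⁻¹' (e ⁻¹' V)) ≤
      (closedBall (0 : Lᗮ) 1).indicator (fun _ ↦ (volume : Measure L) (closedBall 0 D)) y := by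
    intro y
    rcases ((fun x ↦ (x, y)) ⁻¹' (e ⁻¹' V)).eq_empty_or_nonempty with hemp | ⟨x, hx⟩
    · simp [hemp]
    have hxV : (x : E) + y ∈ V := by simpa [he] using hx
    have hy : y ∈ closedBall (0 : Lᗮ) 1 := by
      have h1 : ‖(x : E) + y‖ ≤ 1 := by simpa using hVB hxV
      have h2 := norm_add_orthogonal_sq L x y
      rw [mem_closedBall_zero_iff]
      nlinarith [norm_nonneg x, norm_nonneg y, norm_nonneg ((x : E) + y)]
    rw [indicator_of_mem hy, Measure.addHaar_closedBall_center volume (0 : L),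
      ← Measure.addHaar_closedBall_center volume x]
    refine measure_mono fun z hz ↦ ?_
    have hzV : (z : E) + y ∈ V := by simpa [he] using hz
    have := hslice _ hzV _ hxV (by simpa using L.sub_mem z.2 x.2)
    rw [mem_closedBall, dist_eq_norm, ← Submodule.norm_coe]
    simpa using this
  rw [← hmp.measure_preimage hV.nullMeasurableSet, Measure.volume_eq_prod,
    Measure.prod_apply_symm (hmp.measurable hV)]
  refine (lintegral_mono hslices).trans ?_
  rw [lintegral_indicator_const measurableSet_closedBall]

/-- The product of the unit balls of `L` and `Lᗮ` lies in the ball of radius `√2`. -/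
theorem volume_mul_volume_le_sqrt_two_ball :
    (volume : Measure L) (closedBall 0 1) * (volume : Measure Lᗮ) (closedBall 0 1) ≤
      (volume : Measure E) (closedBall 0 √2) := by
  rw [← (measurePreserving_add_orthogonal L).measure_preimage
    measurableSet_closedBall.nullMeasurableSet, ← Measure.prod_prod, ← Measure.volume_eq_prod]
  refine measure_mono ?_
  rintro ⟨x, y⟩ ⟨hx, hy⟩
  rw [mem_closedBall_zero_iff] at hx hy
  rw [mem_preimage, mem_closedBall_zero_iff]
  refine Real.le_sqrt_of_sq_le ?_
  rw [norm_add_orthogonal_sq]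
  nlinarith [norm_nonneg x, norm_nonneg y]

end OrthogonalSum

/-- By polar coordinates and Jensen's inequality, `{g < 1}` has volume at least `M⁻ⁿ` times that of
the unit ball, where `M` is the Lévy mean of the positively homogeneous function `g`. -/
theorem pow_levyMean_le_volume {n : ℕ} (hn : 1 ≤ n) {g : EuclideanSpace ℝ (Fin n) → ℝ}
    (hg : Continuous g) (hhom : ∀ (r : ℝ) x, 0 ≤ r → g (r • x) = r * g x)
    (hpos : ∀ x, x ≠ 0 → 0 < g x) :
    0 < levyMean n g ∧
    ENNReal.ofReal ((levyMean n g)⁻¹ ^ n) * volume (ball (0 : EuclideanSpace ℝ (Fin n)) 1) ≤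
      volume {x | g x < 1} := by
  have : Nonempty (Fin n) := ⟨⟨0, hn⟩⟩
  set σ := (volume : Measure (EuclideanSpace ℝ (Fin n))).toSphere with hσ
  have : NeZero σ := ⟨Measure.toSphere_ne_zero _⟩
  have hgs : Continuous fun x : sphere (0 : EuclideanSpace ℝ (Fin n)) 1 ↦ g x :=
    hg.comp continuous_subtype_val
  have hgp : ∀ x : sphere (0 : EuclideanSpace ℝ (Fin n)) 1, 0 < g x := fun x ↦
    hpos _ (ne_zero_of_mem_unit_sphere x)
  have hint : ∀ f : sphere (0 : EuclideanSpace ℝ (Fin n)) 1 → ℝ, Continuous f → Integrable f σ :=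
    fun f hf ↦ hf.integrable_of_hasCompactSupport (HasCompactSupport.of_compactSpace f)
  have hσpos : 0 < σ.real univ := measureReal_univ_pos
  set M := levyMean n g with hM
  have hMeq : M * σ.real univ = ∫ x, g x ∂σ := by
    rw [hM, levyMean, average_eq, smul_eq_mul, ← hσ]
    field_simp
  have hMpos : 0 < M := by
    refine pos_of_mul_pos_left ?_ hσpos.le
    rw [hMeq, integral_pos_iff_support_of_nonneg (fun x ↦ (hgp x).le) (hint _ hgs)]
    have : Function.support (fun x : sphere (0 : EuclideanSpace ℝ (Fin n)) 1 ↦ g x) = univ :=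
      eq_univ_of_forall fun x ↦ (hgp x).ne'
    rw [this]
    exact Measure.measure_univ_pos.2 (NeZero.ne _)
  refine ⟨hMpos, ?_⟩
  have hvol : ∫⁻ x, ENNReal.ofReal ((g x)⁻¹ ^ n / n) ∂σ ≤ volume {x | g x < 1} := by
    let T : Set (sphere (0 : EuclideanSpace ℝ (Fin n)) 1 × Ioi (0 : ℝ)) :=
      {p | p.2.1 * g p.1 < 1}
    have hT : MeasurableSet T := (isOpen_lt (by fun_prop) continuous_const).measurableSet
    have hpolar := (Measure.measurePreserving_homeomorphUnitSphereProd
      (volume : Measure (EuclideanSpace ℝ (Fin n)))).measure_preimage hT.nullMeasurableSet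
    rw [comap_subtype_coe_apply (measurableSet_singleton _).compl, Measure.prod_apply hT] at hpolar
    calc ∫⁻ x, ENNReal.ofReal ((g x)⁻¹ ^ n / n) ∂σ
        = ∫⁻ x, Measure.volumeIoiPow (Module.finrank ℝ (EuclideanSpace ℝ (Fin n)) - 1)
            (Prod.mk x ⁻¹' T) ∂σ := by
          refine lintegral_congr fun x ↦ ?_
          have hslice : Prod.mk x ⁻¹' T = Iio ⟨(g x)⁻¹, inv_pos.2 (hgp x)⟩ := by
            ext r
            simp only [T, mem_preimage, mem_ofPred_eq, mem_Iio, ← Subtype.coe_lt_coe]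
            rw [lt_inv_comm₀ r.2 (hgp x), inv_eq_one_div, lt_div_iff₀' r.2]
          rw [hslice, Measure.volumeIoiPow_apply_Iio, finrank_euclideanSpace_fin,
            Nat.sub_add_cancel hn, Nat.cast_pred hn, sub_add_cancel]
      _ = _ := hpolar.symm
      _ ≤ volume {x | g x < 1} := by
        refine measure_mono ?_
        rintro _ ⟨x, hx, rfl⟩
        obtain ⟨p, rfl⟩ := (homeomorphUnitSphereProd (EuclideanSpace ℝ (Fin n))).symm.surjective x
        rw [mem_preimage, Homeomorph.apply_symm_apply] at hx
        rw [mem_ofPred_eq, homeomorphUnitSphereProd_symm_apply_coe, hhom _ _ (le_of_lt p.2.2)]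
        exact hx
  refine le_trans ?_ hvol
  have hinv : Continuous fun x : sphere (0 : EuclideanSpace ℝ (Fin n)) 1 ↦ (g x)⁻¹ ^ n / n :=
    ((hgs.inv₀ fun x ↦ (hgp x).ne').pow n).div_const _
  rw [← ofReal_integral_eq_lintegral_ofReal (hint _ hinv)
    (.of_forall fun x ↦ by have := hgp x; positivity)]
  have htangent : ∀ x : sphere (0 : EuclideanSpace ℝ (Fin n)) 1,
      M⁻¹ ^ n / n * (1 + n - n / M * g x) ≤ (g x)⁻¹ ^ n / n := by
    intro x
    have hx := hgp x
    have h1 := one_add_mul_le_pow (a := M / g x - 1) (by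
      have : 0 < M / g x := by positivity
      linarith) n
    have h2 : 2 - g x / M ≤ M / g x := by
      rw [← sub_nonneg]
      have : M / g x - (2 - g x / M) = (M - g x) ^ 2 / (M * g x) := by field_simp; ring
      rw [this]; positivity
    have hn0 : (0 : ℝ) ≤ n := n.cast_nonneg
    have h3 : 1 + n - n / M * g x ≤ (M / g x) ^ n := by
      rw [add_sub_cancel] at h1
      have : n / M * g x = n * (g x / M) := by ring
      nlinarith
    calc M⁻¹ ^ n / n * (1 + n - n / M * g x) ≤ M⁻¹ ^ n / n * (M / g x) ^ n := by gcongr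
      _ = (g x)⁻¹ ^ n / n := by
        rw [div_mul_eq_mul_div, ← mul_pow]
        congr 2
        field_simp
  have hle := integral_mono (hint _ (by fun_prop)) (hint _ hinv) htangent
  refine le_trans ?_ (ENNReal.ofReal_le_ofReal hle)
  have hcalc : ∫ x : sphere (0 : EuclideanSpace ℝ (Fin n)) 1,
      M⁻¹ ^ n / n * (1 + n - n / M * g x) ∂σ = M⁻¹ ^ n / n * σ.real univ := by
    rw [integral_const_mul, integral_sub (integrable_const _) (hint _ (by fun_prop)),
      integral_const_mul, ← hMeq, integral_const, smul_eq_mul]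
    field_simp
    ring
  have hn0 : (n : ℝ) ≠ 0 := by positivity
  rw [hcalc, hσ, Measure.toSphere_real_apply_univ, finrank_euclideanSpace_fin,
    show M⁻¹ ^ n / n * (n * volume.real (ball (0 : EuclideanSpace ℝ (Fin n)) 1)) =
      M⁻¹ ^ n * volume.real (ball (0 : EuclideanSpace ℝ (Fin n)) 1) by field_simp,
    ENNReal.ofReal_mul (by positivity), ofReal_measureReal measure_ball_lt_top.ne]

/-- There is an absolute constant `c > 0` such that for every convex symmetric body
`V ⊆ B₂ⁿ` and every `m`-dimensional subspace `L` (`1 ≤ m ≤ n`),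
`diam(V ∩ L) ≥ (2c / M_V)^{n/m} · ω_{n,m}`. -/
theorem diam_section_lower_bound :
    ∃ c : ℝ, 0 < c ∧
      ∀ (n m : ℕ), 1 ≤ m → m ≤ n →
        ∀ V : Set (EuclideanSpace ℝ (Fin n)), IsSymmBody n V →
          V ⊆ closedBall (0 : EuclideanSpace ℝ (Fin n)) 1 →
          ∀ L : Submodule ℝ (EuclideanSpace ℝ (Fin n)), Module.finrank ℝ L = m →
            (2 * c / levyMean n (gauge V)) ^ ((n : ℝ) / (m : ℝ)) * omegaNM n m ≤
              diam (V ∩ (L : Set (EuclideanSpace ℝ (Fin n)))) := by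
  refine ⟨1 / 4, by norm_num, fun n m hm hmn V hV hVB L hL ↦ ?_⟩
  obtain ⟨hcomp, hconv, h0, hsymm⟩ := hV
  have hnhds : V ∈ nhds 0 := mem_interior_iff_mem_nhds.1 h0
  have hbdd : Bornology.IsBounded (V ∩ (L : Set (EuclideanSpace ℝ (Fin n)))) :=
    hcomp.isBounded.subset inter_subset_left
  obtain ⟨hMpos, hlow⟩ := pow_levyMean_le_volume (hm.trans hmn) (continuous_gauge hconv hnhds)
    (fun r x hr ↦ by rw [gauge_smul_of_nonneg hr, smul_eq_mul])
    (fun x hx ↦ (gauge_pos (absorbent_nhds_zero hnhds)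
      ((NormedSpace.isVonNBounded_iff ℝ).2 hcomp.isBounded)).2 hx)
  set M := levyMean n (gauge V)
  set D := diam (V ∩ (L : Set (EuclideanSpace ℝ (Fin n))))
  have hD : 0 ≤ D := diam_nonneg
  have hslice : ∀ x ∈ V, ∀ y ∈ V, x - y ∈ L → ‖x - y‖ ≤ D := by
    intro x hx y hy hxy
    have hny : ∀ z ∈ V, -z ∈ V := fun z hz ↦ by rw [hsymm]; simpa using hz
    have hz : (1 / 2 : ℝ) • (x - y) ∈ V := by
      have := hconv hx (hny y hy) (a := 1 / 2) (b := 1 / 2) (by norm_num) (by norm_num)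
        (by norm_num)
      rwa [← smul_add, ← sub_eq_add_neg] at this
    have hzL := L.smul_mem (1 / 2 : ℝ) hxy
    have := dist_le_diam_of_mem hbdd ⟨hz, hzL⟩ ⟨hny _ hz, L.neg_mem hzL⟩
    rwa [dist_eq_norm, sub_neg_eq_add, ← add_smul, add_halves, one_smul] at this
  have hsub : {x | gauge V x < 1} ⊆ V :=
    setOfPred_gauge_lt_one_subset_self hconv (mem_of_mem_nhds hnhds) (absorbent_nhds_zero hnhds)
  have hup := volume_le_of_slices L hcomp.measurableSet hVB hslice
  have hprod := volume_mul_volume_le_sqrt_two_ball L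
  have hvol := hlow.trans ((measure_mono hsub).trans hup)
  have hLperp : Module.finrank ℝ Lᗮ = n - m := by
    have := L.finrank_add_finrank_orthogonal
    rw [finrank_euclideanSpace_fin] at this
    omega
  have hGn : 0 < Real.Gamma ((n : ℝ) / 2 + 1) := Real.Gamma_pos_of_pos (by positivity)
  have hGm : 0 < Real.Gamma ((m : ℝ) / 2 + 1) := Real.Gamma_pos_of_pos (by positivity)
  have hGk : 0 < Real.Gamma (((n : ℝ) - m) / 2 + 1) := Real.Gamma_pos_of_pos (by
    have : (m : ℝ) ≤ n := by exact_mod_cast hmn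
    linarith)
  have hpi : 0 < √Real.pi := Real.sqrt_pos.2 Real.pi_pos
  have hpow : √Real.pi ^ n = √Real.pi ^ m * √Real.pi ^ (n - m) := by
    rw [← pow_add, Nat.add_sub_cancel' hmn]
  rw [← Measure.addHaar_unitClosedBall_eq_addHaar_unitBall] at hvol
  rw [volume_closedBall_finrank _ zero_le_one, volume_closedBall_finrank _ zero_le_one,
    volume_closedBall_finrank _ (by positivity), hLperp, hL, finrank_euclideanSpace_fin,
    Nat.cast_sub hmn, one_pow, one_pow, one_mul, one_mul, ← ENNReal.ofReal_mul (by positivity),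
    ENNReal.ofReal_le_ofReal_iff (by positivity)] at hprod
  rw [volume_closedBall_finrank _ zero_le_one, volume_closedBall_finrank _ zero_le_one,
    volume_closedBall_finrank _ hD, hLperp, hL, finrank_euclideanSpace_fin,
    Nat.cast_sub hmn, one_pow, one_pow, one_mul, one_mul, ← ENNReal.ofReal_mul (by positivity),
    ← ENNReal.ofReal_mul (by positivity), ENNReal.ofReal_le_ofReal_iff (by positivity)] at hvol
  set W := Real.Gamma ((n : ℝ) / 2 + 1) /
    (Real.Gamma (((n : ℝ) - (m : ℝ)) / 2 + 1) * Real.Gamma ((m : ℝ) / 2 + 1)) with hW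
  have hWpos : 0 < W := by positivity
  set κ := √Real.pi ^ n / Real.Gamma ((n : ℝ) / 2 + 1) with hκ
  have hκpos : 0 < κ := by positivity
  have hκW : √Real.pi ^ m / Real.Gamma ((m : ℝ) / 2 + 1) *
      (√Real.pi ^ (n - m) / Real.Gamma (((n : ℝ) - m) / 2 + 1)) = κ * W := by
    rw [hκ, hW, hpow]
    field_simp
  have hW2 : W ≤ √2 ^ n := by
    rw [hκW] at hprod
    nlinarith
  have hDW : M⁻¹ ^ n ≤ D ^ m * W := by
    rw [mul_assoc, hκW] at hvol
    nlinarith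
  have hmain : (2 * (1 / 4) / M) ^ n * W ≤ D ^ m := by
    have hsq : W * W ≤ 2 ^ n := by
      calc W * W ≤ √2 ^ n * √2 ^ n := by gcongr
        _ = 2 ^ n := by rw [← mul_pow, Real.mul_self_sqrt zero_le_two]
    have h2 : (2 * (1 / 4) / M) ^ n = M⁻¹ ^ n / 2 ^ n := by
      rw [← div_pow]
      congr 1
      field_simp
      norm_num
    rw [h2, div_mul_eq_mul_div, div_le_iff₀ (by positivity)]
    calc M⁻¹ ^ n * W ≤ D ^ m * W * W := by gcongr
      _ = D ^ m * (W * W) := by ring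
      _ ≤ D ^ m * 2 ^ n := by gcongr
  have hm0 : m ≠ 0 := by omega
  calc (2 * (1 / 4) / M) ^ ((n : ℝ) / (m : ℝ)) * omegaNM n m
      = ((2 * (1 / 4) / M) ^ n * W) ^ (1 / (m : ℝ)) := by
        rw [Real.mul_rpow (by positivity) hWpos.le, ← Real.rpow_natCast,
          ← Real.rpow_mul (by positivity), div_eq_mul_one_div (n : ℝ), omegaNM]
    _ ≤ (D ^ m) ^ (1 / (m : ℝ)) := by gcongr
    _ = D := by rw [one_div, Real.pow_rpow_inv_natCast hD hm0]
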